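/- Let n ∈ ℕ, p ∈ [0,1], q = 1−p, and θ ∈ [0,1]. Let S ~ Binomial(n,p) and let X be an independent exponential random variable with rate λ satisfying 0 < λ ≤ 1 and λ ≤ 1/√(p·q·n) (the latter vacuous if p·q·n = 0). Assume Pr[S + X > θ·n] < 1/4. Then there is a universal constant C > 0 such that exp(−λ·θ·n) · (q + p·e^{λ})^n ≤ C · Pr[S + X > θ·n]. -/

import Mathlib

/-- `Pr[S = k]` for `S ~ Binomial(n, p)`. -/
noncomputable def binomPMF (n : ℕ) (p : ℝ) (k : ℕ) : ℝ :=
  (n.choose k : ℝ) * p ^ k * (1 - p) ^ (n - k)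

/-- `Pr[X > t]` for `X` an exponential random variable with rate `lam > 0`. -/
noncomputable def expTail (lam t : ℝ) : ℝ :=
  if t ≤ 0 then 1 else Real.exp (-(lam * t))

/-- `Pr[S + X > θ·n]` for `S ~ Binomial(n, p)` and `X ~ Exponential(lam)` independent. -/
noncomputable def prAbove (n : ℕ) (p θ lam : ℝ) : ℝ :=
  ∑ k ∈ Finset.range (n + 1), binomPMF n p k * expTail lam (θ * n - k)

theorem sum_binomPMF (n : ℕ) (p : ℝ) :
    ∑ k ∈ Finset.range (n + 1), binomPMF n p k = 1 := by
  have h := congrArg (Polynomial.eval p) (bernsteinPolynomial.sum ℝ n)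
  simpa [Polynomial.eval_finsetSum, bernsteinPolynomial, binomPMF] using h

theorem variance_binomPMF (n : ℕ) (p : ℝ) :
    ∑ k ∈ Finset.range (n + 1), (n * p - k) ^ 2 * binomPMF n p k = n * p * (1 - p) := by
  have h := congrArg (Polynomial.eval p) (bernsteinPolynomial.variance ℝ n)
  simpa [Polynomial.eval_finsetSum, bernsteinPolynomial, binomPMF] using h

theorem binomPMF_nonneg {p : ℝ} (hp : 0 ≤ p) (hp1 : p ≤ 1) (n k : ℕ) : 0 ≤ binomPMF n p k := by
  have : 0 ≤ 1 - p := sub_nonneg.2 hp1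
  unfold binomPMF
  positivity

/-- The moment generating function of a Bernoulli variable, at arguments in `[0, 1]`. -/
theorem bernoulli_mgf_le {p lam : ℝ} (hp : 0 ≤ p) (hp1 : p ≤ 1) (hl : 0 ≤ lam) (hl1 : lam ≤ 1) :
    (1 - p) + p * Real.exp lam ≤ Real.exp (lam * p + lam ^ 2 * (p * (1 - p))) := by
  have exp_le {x : ℝ} (hx : |x| ≤ 1) : Real.exp x ≤ 1 + x + x ^ 2 := by
    linarith [(abs_le.1 (Real.abs_exp_sub_one_sub_id_le hx)).2]
  have h1 : Real.exp (-(lam * p)) ≤ 1 + -(lam * p) + (-(lam * p)) ^ 2 :=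
    exp_le (abs_le.2 ⟨by nlinarith, by nlinarith⟩)
  have h2 : Real.exp (lam * (1 - p)) ≤ 1 + lam * (1 - p) + (lam * (1 - p)) ^ 2 :=
    exp_le (abs_le.2 ⟨by nlinarith, by nlinarith⟩)
  have h3 := Real.add_one_le_exp (lam ^ 2 * (p * (1 - p)))
  have h4 : (1 - p) * Real.exp (-(lam * p)) + p * Real.exp (lam * (1 - p))
      ≤ Real.exp (lam ^ 2 * (p * (1 - p))) := by
    have h5 := mul_le_mul_of_nonneg_left h1 (sub_nonneg.2 hp1)
    have h6 := mul_le_mul_of_nonneg_left h2 hp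
    linarith
  calc (1 - p) + p * Real.exp lam
      = Real.exp (lam * p)
          * ((1 - p) * Real.exp (-(lam * p)) + p * Real.exp (lam * (1 - p))) := by
        rw [mul_add, mul_left_comm, ← Real.exp_add, mul_left_comm, ← Real.exp_add,
          add_neg_cancel, Real.exp_zero, mul_one, ← mul_add, add_sub_cancel, mul_one]
    _ ≤ Real.exp (lam * p) * Real.exp (lam ^ 2 * (p * (1 - p))) := by gcongr
    _ = _ := (Real.exp_add _ _).symm

theorem expTail_lower_bound (lam t d : ℝ) :
    min 1 (Real.exp (lam * d - 2)) * (1 - lam ^ 2 * (t + d) ^ 2 / 4) ≤ expTail lam t := by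
  have hm : 0 < min 1 (Real.exp (lam * d - 2)) := lt_min one_pos (Real.exp_pos _)
  by_cases hy : lam * (t + d) ≤ 2
  · have hle : min 1 (Real.exp (lam * d - 2)) * (1 - lam ^ 2 * (t + d) ^ 2 / 4)
        ≤ min 1 (Real.exp (lam * d - 2)) :=
      mul_le_of_le_one_right hm.le (by nlinarith [sq_nonneg (lam * (t + d))])
    refine hle.trans ?_
    unfold expTail
    split_ifs
    · exact min_le_left _ _
    · exact (min_le_right _ _).trans (Real.exp_le_exp.2 (by linarith))
  · have hneg : 1 - lam ^ 2 * (t + d) ^ 2 / 4 ≤ 0 := by nlinarith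
    have h0 : 0 ≤ expTail lam t := by
      unfold expTail
      split_ifs <;> positivity
    exact (mul_nonpos_of_nonneg_of_nonpos hm.le hneg).trans h0

theorem prAbove_lower_bound {n : ℕ} {p θ lam : ℝ} (hp : 0 ≤ p) (hp1 : p ≤ 1)
    (hvar : lam ^ 2 * (p * (1 - p) * n) ≤ 1) :
    3 / 4 * min 1 (Real.exp (lam * (n * p - θ * n) - 2)) ≤ prAbove n p θ lam := by
  set m := min 1 (Real.exp (lam * (n * p - θ * n) - 2)) with hm
  have hm0 : 0 < m := lt_min one_pos (Real.exp_pos _)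
  have hsum : ∑ k ∈ Finset.range (n + 1),
      binomPMF n p k * (m * (1 - lam ^ 2 * (n * p - k) ^ 2 / 4))
      = m * (1 - lam ^ 2 * (n * p * (1 - p)) / 4) := by
    rw [← variance_binomPMF n p]
    nth_rewrite 2 [← sum_binomPMF n p]
    rw [Finset.mul_sum, Finset.sum_div, ← Finset.sum_sub_distrib, Finset.mul_sum]
    exact Finset.sum_congr rfl fun k _ => by ring
  calc 3 / 4 * m ≤ m * (1 - lam ^ 2 * (n * p * (1 - p)) / 4) := by nlinarith
    _ = _ := hsum.symm
    _ ≤ prAbove n p θ lam := by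
      refine Finset.sum_le_sum fun k _ =>
        mul_le_mul_of_nonneg_left ?_ (binomPMF_nonneg hp hp1 n k)
      have h := expTail_lower_bound lam (θ * n - k) (n * p - θ * n)
      rwa [show θ * n - k + (n * p - θ * n) = n * p - k by ring] at h

/-- If `S ~ Binomial(n,p)`, `X ~ Exponential(lam)` independent, `0 < lam ≤ 1`,
`lam ≤ 1/√(p(1−p)n)`, and `Pr[S + X > θn] < 1/4`, then
`exp(−λθn)·(q + p·e^λ)^n ≤ C · Pr[S + X > θn]` for a universal constant `C`. -/
theorem exp_moment_le_prAbove :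
    ∃ C : ℝ, 0 < C ∧
      ∀ (n : ℕ) (p θ lam : ℝ),
        0 ≤ p → p ≤ 1 → 0 ≤ θ → θ ≤ 1 →
        0 < lam → lam ≤ 1 →
        lam * Real.sqrt (p * (1 - p) * n) ≤ 1 →
        prAbove n p θ lam < 1 / 4 →
        Real.exp (-(lam * θ * n)) * ((1 - p) + p * Real.exp lam) ^ n
          ≤ C * prAbove n p θ lam := by
  refine ⟨4 / 3 * Real.exp 3, by positivity, ?_⟩
  intro n p θ lam hp hp1 _ _ hl hl1 hsqrt hpr
  have hq : 0 ≤ 1 - p := sub_nonneg.2 hp1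
  have hvar : lam ^ 2 * (p * (1 - p) * n) ≤ 1 := by
    have h := pow_le_one₀ (n := 2) (by positivity) hsqrt
    rwa [mul_pow, Real.sq_sqrt (by positivity)] at h
  have hlow := prAbove_lower_bound (θ := θ) hp hp1 hvar
  have hmin : min 1 (Real.exp (lam * (n * p - θ * n) - 2))
      = Real.exp (lam * (n * p - θ * n) - 2) := by
    rcases min_choice 1 (Real.exp (lam * (n * p - θ * n) - 2)) with h | h
    · rw [h] at hlow
      linarith
    · exact h
  rw [hmin] at hlow
  calc Real.exp (-(lam * θ * n)) * ((1 - p) + p * Real.exp lam) ^ n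
      ≤ Real.exp (-(lam * θ * n)) * Real.exp (lam * p + lam ^ 2 * (p * (1 - p))) ^ n := by
        gcongr
        exact bernoulli_mgf_le hp hp1 hl.le hl1
    _ = Real.exp (lam * (n * p - θ * n) + lam ^ 2 * (p * (1 - p) * n)) := by
        rw [← Real.exp_nat_mul, ← Real.exp_add]
        ring_nf
    _ ≤ Real.exp (3 + (lam * (n * p - θ * n) - 2)) := Real.exp_le_exp.2 (by linarith)
    _ = 4 / 3 * Real.exp 3 * (3 / 4 * Real.exp (lam * (n * p - θ * n) - 2)) := by
        rw [Real.exp_add]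
        ring
    _ ≤ 4 / 3 * Real.exp 3 * prAbove n p θ lam := by gcongr
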